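/- arXiv:2402.10656 — 2 statements merged into one kernel-verified Lean document; each statement's English description precedes it below -/
import Mathlib

section
/- Let k ≥ 3 be an integer, S > 0 and N ≥ 1. There exists a constant C > 0, depending only on k, S and N, such that for every ε ∈ (0,1), every bounded open interval I, and every function u that is k times continuously differentiable on a neighbourhood of the closure of I with F_ε(u; I) ≤ S, if (i) |u'(t)| < 1/√ε for all t ∈ I, and (ii) the set { t ∈ I : |u^{(ℓ)}(t)| < 1/(N ε^ℓ) for all ℓ ∈ {2,…,k−1} } has Lebesgue measure zero, then |I| ≤ C ε^{(2k−3)/(2k−4)}. -/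
open MeasureTheory Set

/-- The localized energy `F_ε(u; (a,b)) = ∫_{(a,b)} min{(u')², 1/ε} + ε^{2k-1} ∫_{(a,b)} (u^{(k)})²`. -/
noncomputable def Fe (k : ℕ) (ε : ℝ) (u : ℝ → ℝ) (a b : ℝ) : ℝ :=
  (∫ t in Ioo a b, min ((deriv u t) ^ 2) (1 / ε)) +
    ε ^ (2 * k - 1) * ∫ t in Ioo a b, (iteratedDeriv k u t) ^ 2

theorem aux_points (g : ℕ → ℝ → ℝ) (n : ℕ) (p q h A : ℝ) (hh : 0 < h)
    (hd : ∀ j ≤ n, ∀ t ∈ Icc p q, HasDerivAt (g j) (g (j+1) t) t)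
    (hA : ∀ x y, p ≤ x → y ≤ q → y - x = h → ∃ s ∈ Icc x y, |g 0 s| ≤ A) :
    ∀ j ≤ n, ∀ x y, p ≤ x → y ≤ q → y - x = 3 ^ j * h →
      ∃ s ∈ Icc x y, |g j s| ≤ (2 / h) ^ j * A := by
  intro j
  induction j with
  | zero =>
    intro _ x y hx hy hxy
    simpa using hA x y hx hy (by simpa using hxy)
  | succ j ih =>
    intro hj x y hx hy hxy
    have hpow : (1:ℝ) ≤ 3 ^ j := one_le_pow₀ (by norm_num)
    have hH : h ≤ 3 ^ j * h := by nlinarith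
    have hxy' : y - x = 3 * (3 ^ j * h) := by rw [hxy, pow_succ]; ring
    obtain ⟨s, hs, hs'⟩ := ih (by omega) x (x + 3 ^ j * h) hx (by linarith) (by ring)
    obtain ⟨r, hr, hr'⟩ := ih (by omega) (y - 3 ^ j * h) y (by linarith) hy (by ring)
    have hsr : h ≤ r - s := by linarith [hs.2, hr.1]
    have hsr' : s < r := by linarith
    have hsub : Icc s r ⊆ Icc p q := Icc_subset_Icc (hx.trans hs.1) (hr.2.trans hy)
    obtain ⟨c, hc, hc'⟩ := exists_hasDerivAt_eq_slope (g j) (g (j+1)) hsr'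
      (fun t ht => (hd j (by omega) t (hsub ht)).continuousAt.continuousWithinAt)
      (fun t ht => hd j (by omega) t (hsub (Ioo_subset_Icc_self ht)))
    refine ⟨c, ⟨hs.1.trans hc.1.le, hc.2.le.trans hr.2⟩, ?_⟩
    rw [hc', abs_div, abs_of_pos (by linarith : 0 < r - s)]
    have h1 : |g j r - g j s| ≤ 2 * ((2 / h) ^ j * A) := by
      have := abs_sub (g j r) (g j s)
      linarith
    calc |g j r - g j s| / (r - s) ≤ 2 * ((2 / h) ^ j * A) / h := by
          apply div_le_div₀ _ h1 hh hsr
          exact (abs_nonneg _).trans h1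
      _ = _ := by rw [pow_succ]; ring

theorem aux_interp (g : ℕ → ℝ → ℝ) (n : ℕ) (p q A B : ℝ) (hpq : p < q)
    (hd : ∀ j ≤ n, ∀ t ∈ Icc p q, HasDerivAt (g j) (g (j+1) t) t)
    (hB : ∀ s ∈ Icc p q, ∀ t ∈ Icc p q, |g n t - g n s| ≤ B)
    (hA : ∀ x y, p ≤ x → y ≤ q → y - x = (q - p) / 3 ^ n → ∃ s ∈ Icc x y, |g 0 s| ≤ A) :
    ∀ i ≤ n, ∀ t ∈ Icc p q, |g (n - i) t| * (q - p) ^ (n - i) ≤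
      (i + 1) * ((2 * 3 ^ n) ^ n * A) + (q - p) ^ n * B := by
  have hM : 0 < q - p := by linarith
  have h3 : (1:ℝ) ≤ 3 ^ n := one_le_pow₀ (by norm_num)
  set h := (q - p) / 3 ^ n with hh
  have hh0 : 0 < h := by positivity
  have hhM : 3 ^ n * h = q - p := by rw [hh]; field_simp
  have hA0 : 0 ≤ A := by
    obtain ⟨s, _, hs⟩ := hA p (p + h) le_rfl (by nlinarith) (by ring)
    exact (abs_nonneg _).trans hs
  have hpt := aux_points g n p q h A hh0 hd hA
  have hpt' : ∀ j ≤ n, ∃ s ∈ Icc p q, |g j s| * (q - p) ^ j ≤ (2 * 3 ^ n) ^ n * A := by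
    intro j hj
    have h3j : (3:ℝ) ^ j ≤ 3 ^ n := pow_le_pow_right₀ (by norm_num) hj
    have hle : p + 3 ^ j * h ≤ q := by nlinarith
    obtain ⟨s, hs, hs'⟩ := hpt j hj p (p + 3 ^ j * h) le_rfl hle (by ring)
    refine ⟨s, ⟨hs.1, hs.2.trans hle⟩, ?_⟩
    calc |g j s| * (q - p) ^ j ≤ ((2 / h) ^ j * A) * (q - p) ^ j := by gcongr
      _ = (2 / h * (q - p)) ^ j * A := by rw [mul_pow]; ring
      _ = (2 * 3 ^ n) ^ j * A := by
          congr 2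
          rw [← hhM]; field_simp
      _ ≤ _ := by
          gcongr
          linarith
  intro i
  induction i with
  | zero =>
    intro _ t ht
    obtain ⟨s, hs, hs'⟩ := hpt' n le_rfl
    have h1 := hB s hs t ht
    have h2 : |g n t| ≤ |g n s| + B := by
      have := abs_sub_abs_le_abs_sub (g n t) (g n s)
      linarith
    have : |g n t| * (q - p) ^ n ≤ (|g n s| + B) * (q - p) ^ n := by gcongr
    simp only [Nat.sub_zero, Nat.cast_zero]
    linarith
  | succ i ih =>
    intro hi t ht
    have ih := ih (by omega)
    obtain ⟨j, hj⟩ : ∃ j, n - (i + 1) = j := ⟨_, rfl⟩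
    have hj' : n - i = j + 1 := by omega
    rw [hj]
    rw [hj'] at ih
    obtain ⟨s, hs, hs'⟩ := hpt' j (by omega)
    set R := (i + 1) * ((2 * 3 ^ n) ^ n * A) + (q - p) ^ n * B with hR
    have hder : ∀ x ∈ Icc p q, ‖g (j+1) x‖ ≤ R / (q - p) ^ (j+1) := by
      intro x hx
      rw [le_div_iff₀ (by positivity)]
      exact ih x hx
    have hmv := Convex.norm_image_sub_le_of_norm_hasDerivWithin_le (𝕜 := ℝ) (f := g j) (f' := g (j+1))
      (fun x hx => (hd j (by omega) x hx).hasDerivWithinAt) hder (convex_Icc p q) hs ht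
    rw [Real.norm_eq_abs, Real.norm_eq_abs] at hmv
    have hR0 : 0 ≤ R / (q - p) ^ (j+1) := (norm_nonneg _).trans (hder t ht)
    have hst : |t - s| ≤ q - p := by
      rw [abs_le]; constructor <;> linarith [ht.1, ht.2, hs.1, hs.2]
    have h1 : |g j t - g j s| ≤ R / (q - p) ^ (j+1) * (q - p) := hmv.trans (by gcongr)
    have h2 : |g j t| ≤ |g j s| + R / (q - p) ^ (j+1) * (q - p) := by
      have := abs_sub_abs_le_abs_sub (g j t) (g j s)
      linarith
    have h3 : |g j t| * (q - p) ^ j ≤ (|g j s| + R / (q - p) ^ (j+1) * (q - p)) * (q - p) ^ j := by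
      gcongr
    have h4 : R / (q - p) ^ (j+1) * (q - p) * (q - p) ^ j = R := by
      rw [pow_succ]; field_simp
    push_cast
    have : (|g j s| + R / (q - p) ^ (j+1) * (q - p)) * (q - p) ^ j = |g j s| * (q - p) ^ j + R := by
      rw [add_mul, h4]
    rw [this] at h3
    rw [hR] at h3
    linarith

theorem aux_osc (f f' : ℝ → ℝ) (p q : ℝ)
    (hd : ∀ t ∈ Icc p q, HasDerivAt f (f' t) t) (hc : ContinuousOn f' (Icc p q))
    (s t : ℝ) (hs : s ∈ Icc p q) (ht : t ∈ Icc p q) :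
    (f t - f s) ^ 2 ≤ (q - p) * ∫ x in p..q, (f' x) ^ 2 := by
  wlog hst : s ≤ t generalizing s t
  · have := this t s ht hs (by linarith)
    nlinarith
  have hpq : p ≤ q := hs.1.trans hs.2
  have hsub : Icc s t ⊆ Icc p q := Icc_subset_Icc hs.1 ht.2
  have hc' : ContinuousOn f' (uIcc s t) := by rw [uIcc_of_le hst]; exact hc.mono hsub
  have hmono : ∫ x in s..t, (f' x) ^ 2 ≤ ∫ x in p..q, (f' x) ^ 2 := by
    apply intervalIntegral.integral_mono_interval hs.1 hst ht.2
    · exact Filter.Eventually.of_forall fun x => sq_nonneg _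
    · exact (by rw [uIcc_of_le hpq]; exact hc.pow 2 : ContinuousOn (fun x => (f' x)^2) (uIcc p q)).intervalIntegrable
  have hI0 : 0 ≤ ∫ x in p..q, (f' x) ^ 2 :=
    intervalIntegral.integral_nonneg hpq fun x _ => sq_nonneg _
  have hftc : ∫ x in s..t, f' x = f t - f s :=
    intervalIntegral.integral_eq_sub_of_hasDerivAt
      (by rw [uIcc_of_le hst]; exact fun x hx => hd x (hsub hx)) hc'.intervalIntegrable
  rcases hst.eq_or_lt with rfl | hlt
  · simp only [sub_self]
    nlinarith
  have key : ∀ c : ℝ, 0 ≤ (∫ x in s..t, (f' x) ^ 2) - 2 * c * (f t - f s) + c ^ 2 * (t - s) := by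
    intro c
    have h0 : 0 ≤ ∫ x in s..t, ((f' x) ^ 2 - 2 * c * f' x + c ^ 2) :=
      intervalIntegral.integral_nonneg hst fun x _ => by nlinarith [sq_nonneg (f' x - c)]
    rw [intervalIntegral.integral_add, intervalIntegral.integral_sub,
      intervalIntegral.integral_const_mul, hftc] at h0
    · simpa [mul_comm] using h0
    · exact (hc'.pow 2).intervalIntegrable
    · exact (hc'.const_smul (2*c)).intervalIntegrable
    · exact ((hc'.pow 2).sub (hc'.const_smul (2*c))).intervalIntegrable
    · simp
  have k := key ((f t - f s) / (t - s))
  have hts : 0 < t - s := by linarith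
  have k2 : (f t - f s) ^ 2 ≤ (t - s) * ∫ x in s..t, (f' x) ^ 2 := by
    have : (∫ x in s..t, (f' x) ^ 2) - 2 * ((f t - f s) / (t - s)) * (f t - f s)
      + ((f t - f s) / (t - s)) ^ 2 * (t - s) = (∫ x in s..t, (f' x) ^ 2) - (f t - f s)^2 / (t - s) := by
      field_simp; ring
    rw [this] at k
    have : (f t - f s)^2 / (t - s) ≤ ∫ x in s..t, (f' x) ^ 2 := by linarith
    rw [div_le_iff₀ hts] at this
    linarith
  calc _ ≤ _ := k2
    _ ≤ (t - s) * ∫ x in p..q, (f' x) ^ 2 := by gcongr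
    _ ≤ _ := by gcongr <;> linarith [hs.1, ht.2]

theorem aux_core (g : ℕ → ℝ → ℝ) (n : ℕ) (p q A S N ε μ : ℝ) (hε : 0 < ε)
    (hN : 1 ≤ N) (hS : 0 < S) (hμ : 0 < μ) (hμ1 : μ ≤ 1) (hμS : 4 * N ^ 2 * S * μ ≤ 1)
    (hM : q - p = ε * μ)
    (hd : ∀ j ≤ n, ∀ t ∈ Icc p q, HasDerivAt (g j) (g (j+1) t) t)
    (hc : ContinuousOn (g (n+1)) (Icc p q))
    (hE : ε ^ (2 * n + 3) * ∫ x in p..q, (g (n+1) x) ^ 2 ≤ S)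
    (hA : ∀ x y, p ≤ x → y ≤ q → y - x = (q - p) / 3 ^ n → ∃ s ∈ Icc x y, |g 0 s| ≤ A)
    (hbad : ∃ t ∈ Icc p q, ∃ j, j ≤ n ∧ 1 / (N * ε ^ (j+1)) ≤ |g j t|) :
    μ ^ n ≤ 2 * N * ((n + 1) * (2 * 3 ^ n) ^ n) * ε * A := by
  have hMpos : 0 < q - p := by rw [hM]; positivity
  have h3 : (1:ℝ) ≤ 3 ^ n := one_le_pow₀ (by norm_num)
  have hA0 : 0 ≤ A := by
    obtain ⟨s, _, hs⟩ := hA p (p + (q - p) / 3 ^ n) le_rfl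
      (by linarith [div_le_self hMpos.le h3]) (by ring)
    exact (abs_nonneg _).trans hs
  have hB : ∀ s ∈ Icc p q, ∀ t ∈ Icc p q, |g n t - g n s| ≤ Real.sqrt (μ * S) / ε ^ (n+1) := by
    intro s hs t ht
    have h1 := aux_osc (g n) (g (n+1)) p q (hd n le_rfl) hc s t hs ht
    apply abs_le_of_sq_le_sq _ (by positivity)
    rw [div_pow, Real.sq_sqrt (by positivity)]
    rw [le_div_iff₀ (by positivity)]
    rw [hM] at h1
    calc (g n t - g n s) ^ 2 * (ε ^ (n+1)) ^ 2
        ≤ (ε * μ * ∫ x in p..q, (g (n+1) x) ^ 2) * (ε ^ (n+1)) ^ 2 := by gcongr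
      _ = μ * (ε ^ (2 * n + 3) * ∫ x in p..q, (g (n+1) x) ^ 2) := by ring
      _ ≤ μ * S := by gcongr
  obtain ⟨t, ht, j, hj, hjt⟩ := hbad
  have key := aux_interp g n p q A _ (by linarith) hd hB hA (n - j) (by omega) t ht
  rw [show n - (n - j) = j by omega, hM] at key
  have hcast : (((n - j : ℕ) : ℝ) + 1) ≤ n + 1 := by
    have : ((n - j : ℕ) : ℝ) ≤ n := by exact_mod_cast Nat.sub_le n j
    linarith
  have hN0 : 0 < N := by linarith
  have hsq : N * Real.sqrt (μ * S) ≤ 1 / 2 := by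
    have : Real.sqrt (μ * S) ≤ 1 / (2 * N) := by
      apply Real.sqrt_le_iff.2 ⟨by positivity, ?_⟩
      rw [div_pow, le_div_iff₀ (by positivity)]
      nlinarith
    calc N * Real.sqrt (μ * S) ≤ N * (1 / (2 * N)) := by gcongr
      _ = 1 / 2 := by field_simp
  have hlow : μ ^ j / (N * ε) ≤ |g j t| * (ε * μ) ^ j := by
    calc μ ^ j / (N * ε) = 1 / (N * ε ^ (j+1)) * (ε * μ) ^ j := by
          rw [mul_pow]; field_simp; ring
      _ ≤ _ := by gcongr
  have hup : |g j t| * (ε * μ) ^ j ≤ ((n + 1) * (2 * 3 ^ n) ^ n) * A + μ ^ n * Real.sqrt (μ * S) / ε := by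
    calc _ ≤ _ := key
      _ ≤ (n + 1) * ((2 * 3 ^ n) ^ n * A) + (ε * μ) ^ n * (Real.sqrt (μ * S) / ε ^ (n + 1)) := by
          gcongr
      _ = _ := by rw [mul_pow ε μ n, pow_succ]; field_simp
  have h := hlow.trans hup
  rw [div_le_iff₀ (by positivity)] at h
  have h' : μ ^ j ≤ N * ((n + 1) * (2 * 3 ^ n) ^ n) * ε * A + μ ^ n * (N * Real.sqrt (μ * S)) := by
    refine h.trans (le_of_eq ?_)
    field_simp
  have hpow : μ ^ n ≤ μ ^ j := pow_le_pow_of_le_one hμ.le hμ1 hj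
  have h5 : μ ^ n * (N * Real.sqrt (μ * S)) ≤ μ ^ n * (1/2) := by gcongr
  linarith

theorem aux_deriv (k : ℕ) (u : ℝ → ℝ) (U : Set ℝ) (hU : IsOpen U) (hu : ContDiffOn ℝ k u U)
    (j : ℕ) (hj : j < k) (t : ℝ) (ht : t ∈ U) :
    HasDerivAt (iteratedDeriv j u) (iteratedDeriv (j+1) u t) t := by
  rw [iteratedDeriv_succ]
  apply DifferentiableAt.hasDerivAt
  have h1 := (hu.differentiableOn_iteratedDerivWithin (m := j) (by exact_mod_cast hj)
    hU.uniqueDiffOn t ht).differentiableAt (hU.mem_nhds ht)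
  refine h1.congr_of_eventuallyEq ?_
  filter_upwards [hU.mem_nhds ht] with x hx
  exact (iteratedDerivWithin_of_isOpen hU hx).symm

theorem aux_cont (k : ℕ) (u : ℝ → ℝ) (U : Set ℝ) (hU : IsOpen U) (hu : ContDiffOn ℝ k u U) :
    ContinuousOn (iteratedDeriv k u) U := by
  have h1 := hu.continuousOn_iteratedDerivWithin (m := k) le_rfl hU.uniqueDiffOn
  exact h1.congr fun x hx => (iteratedDerivWithin_of_isOpen hU hx).symm

/-- pigeonhole -/
theorem aux_pigeon (f : ℝ → ℝ) (a b : ℝ) (hab : a ≤ b) (hc : ContinuousOn f (Icc a b)) (P : ℕ)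
    (hP : 0 < P) : ∃ p q, a ≤ p ∧ q ≤ b ∧ q - p = (b - a) / P ∧
      (P : ℝ) * ∫ x in p..q, f x ≤ ∫ x in a..b, f x := by
  have hP' : (0:ℝ) < P := by exact_mod_cast hP
  set z : ℕ → ℝ := fun i => a + i * ((b - a) / P) with hz
  have hδ : 0 ≤ (b - a) / P := div_nonneg (by linarith) hP'.le
  have hzP : z P = b := by simp only [hz]; field_simp; ring
  have hz0 : z 0 = a := by simp [hz]
  have hmono : Monotone z := by
    intro i j hij
    simp only [hz]
    gcongr
  have hmem : ∀ i ≤ P, z i ∈ Icc a b := fun i hi =>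
    ⟨by rw [← hz0]; exact hmono (Nat.zero_le i), by rw [← hzP]; exact hmono hi⟩
  have hsum : ∑ i ∈ Finset.range P, ∫ x in z i..z (i+1), f x = ∫ x in a..b, f x := by
    rw [intervalIntegral.sum_integral_adjacent_intervals, hz0, hzP]
    intro i hi
    apply ContinuousOn.intervalIntegrable
    apply hc.mono
    rw [uIcc_of_le (hmono (Nat.le_succ i))]
    exact Icc_subset_Icc (hmem i (by omega)).1 (hmem (i+1) (by omega)).2
  obtain ⟨i, hi, hi'⟩ := Finset.exists_le_of_sum_le (s := Finset.range P)
    (f := fun i => ∫ x in z i..z (i+1), f x) (g := fun _ => (∫ x in a..b, f x) / P)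
    ⟨0, Finset.mem_range.2 hP⟩ (by
      rw [hsum]; simp; field_simp; rfl)
  have hi := Finset.mem_range.1 hi
  refine ⟨z i, z (i+1), (hmem i hi.le).1, (hmem (i+1) hi).2, ?_, ?_⟩
  · simp only [hz]; push_cast; ring
  · rw [le_div_iff₀ hP'] at hi'
    linarith

theorem aux_avg (f : ℝ → ℝ) (p q x y T : ℝ) (hpx : p ≤ x) (hxy : x < y) (hyq : y ≤ q)
    (hc : ContinuousOn f (Icc p q)) (hT : ∫ r in p..q, (f r) ^ 2 ≤ T) :
    ∃ s ∈ Icc x y, |f s| ≤ Real.sqrt (T / (y - x)) := by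
  by_contra! hcon
  have hpq : p ≤ q := by linarith
  have hyx : 0 < y - x := by linarith
  have hcI : ContinuousOn (fun r => (f r)^2) (Icc p q) := hc.pow 2
  have hmono : ∫ r in x..y, (f r) ^ 2 ≤ ∫ r in p..q, (f r) ^ 2 := by
    apply intervalIntegral.integral_mono_interval hpx hxy.le hyq
    · exact Filter.Eventually.of_forall fun x => sq_nonneg _
    · exact (by rw [uIcc_of_le hpq]; exact hcI : ContinuousOn (fun x => (f x)^2) (uIcc p q)).intervalIntegrable
  have hT0 : 0 ≤ T := le_trans (intervalIntegral.integral_nonneg hpq fun x _ => sq_nonneg _) hT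
  have hlt : ∫ r in x..y, (T / (y - x)) < ∫ r in x..y, (f r) ^ 2 := by
    apply intervalIntegral.integral_lt_integral_of_continuousOn_of_le_of_exists_lt hxy
      continuousOn_const (hcI.mono (Icc_subset_Icc hpx hyq))
    · intro r hr
      have := hcon r (Ioc_subset_Icc_self hr)
      rw [← sq_abs]
      exact (Real.lt_sq_of_sqrt_lt this).le
    · refine ⟨x, ⟨le_rfl, hxy.le⟩, ?_⟩
      rw [← sq_abs]
      exact Real.lt_sq_of_sqrt_lt (hcon x ⟨le_rfl, hxy.le⟩)
  rw [intervalIntegral.integral_const, smul_eq_mul, mul_div_cancel₀ _ hyx.ne'] at hlt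
  linarith

/-- Lemma 4.1 of the paper: estimate for intervals with large derivatives.
If `|u'| < 1/√ε` on `I = (a,b)` and the set of points of `I` where all derivatives of
order `2,…,k-1` are below the thresholds `1/(Nε^ℓ)` is negligible, then
`|I| ≤ C ε^{(2k-3)/(2k-4)}`. -/
theorem length_bound_large_derivatives (k : ℕ) (hk : 3 ≤ k) (S : ℝ) (hS : 0 < S)
    (N : ℝ) (hN : 1 ≤ N) :
    ∃ C : ℝ, 0 < C ∧
      ∀ ε ∈ Ioo (0:ℝ) 1, ∀ a b : ℝ, a < b →
      ∀ u : ℝ → ℝ, (∃ U : Set ℝ, IsOpen U ∧ Icc a b ⊆ U ∧ ContDiffOn ℝ k u U) →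
      Fe k ε u a b ≤ S →
      (∀ t ∈ Ioo a b, |deriv u t| < 1 / Real.sqrt ε) →
      volume {t ∈ Ioo a b |
        ∀ ℓ : ℕ, 2 ≤ ℓ → ℓ ≤ k - 1 → |iteratedDeriv ℓ u t| < 1 / (N * ε ^ ℓ)} = 0 →
      b - a ≤ C * ε ^ ((2 * (k:ℝ) - 3) / (2 * (k:ℝ) - 4)) := by
  obtain ⟨n, rfl⟩ : ∃ n, k = n + 2 := ⟨k - 2, by omega⟩
  have hn : 1 ≤ n := by omega
  have hnR : (1:ℝ) ≤ n := by exact_mod_cast hn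
  have hN0 : 0 < N := by linarith
  set μ1 : ℝ := min 1 (1 / (4 * N ^ 2 * S)) with hμ1
  have hμ1pos : 0 < μ1 := by rw [hμ1]; positivity
  have hμ1le : μ1 ≤ 1 := min_le_left _ _
  have hμ1S : 4 * N ^ 2 * S * μ1 ≤ 1 := by
    have : μ1 ≤ 1 / (4 * N ^ 2 * S) := min_le_right _ _
    rw [le_div_iff₀ (by positivity)] at this
    linarith
  set K : ℝ := 2 * N * ((n + 1) * (2 * 3 ^ n) ^ n) with hK
  have hK0 : 0 < K := by positivity
  have hC2 : 0 < K ^ 2 * S * 3 ^ n / (μ1 / 2) ^ (2 * n) := by positivity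
  refine ⟨K ^ (1 / (n:ℝ)) + K ^ 2 * S * 3 ^ n / (μ1 / 2) ^ (2 * n), by positivity, ?_⟩
  rintro ε ⟨hε, hε1⟩ a b hab u ⟨U, hU, hIU, hu⟩ hF hv hnull
  have hexp : (2 * ((n + 2 : ℕ):ℝ) - 3) / (2 * ((n + 2 : ℕ):ℝ) - 4) = 1 + 1 / (2 * n) := by
    push_cast
    have : (2 * ((n:ℝ) + 2) - 4) = 2 * n := by ring
    rw [this]; field_simp; ring
  rw [hexp]
  set g : ℕ → ℝ → ℝ := fun j => iteratedDeriv (j + 1) u with hg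
  have hg0 : g 0 = deriv u := by simp [hg, iteratedDeriv_one]
  have hd : ∀ j ≤ n, ∀ t ∈ Icc a b, HasDerivAt (g j) (g (j+1) t) t := fun j hj t ht =>
    aux_deriv (n + 2) u U hU hu (j + 1) (by omega) t (hIU ht)
  have hc : ContinuousOn (g (n+1)) (Icc a b) := (aux_cont (n + 2) u U hU hu).mono hIU
  have hc0 : ContinuousOn (g 0) (Icc a b) := fun t ht =>
    (hd 0 (Nat.zero_le _) t ht).continuousAt.continuousWithinAt
  have hE1 : ∫ x in a..b, (g 0 x) ^ 2 = ∫ t in Ioo a b, min ((deriv u t) ^ 2) (1 / ε) := by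
    rw [intervalIntegral.integral_of_le hab.le, integral_Ioc_eq_integral_Ioo, hg0]
    apply setIntegral_congr_fun measurableSet_Ioo
    intro t ht
    have h1 := hv t ht
    symm
    apply min_eq_left
    have h2 : |deriv u t| ^ 2 ≤ (1 / Real.sqrt ε) ^ 2 := by gcongr
    rwa [sq_abs, div_pow, Real.sq_sqrt hε.le, one_pow] at h2
  have hE2 : ∫ x in a..b, (g (n+1) x) ^ 2 = ∫ t in Ioo a b, (iteratedDeriv (n+2) u t) ^ 2 := by
    rw [intervalIntegral.integral_of_le hab.le, integral_Ioc_eq_integral_Ioo]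
  have hI1 : 0 ≤ ∫ x in a..b, (g 0 x) ^ 2 :=
    intervalIntegral.integral_nonneg hab.le fun x _ => sq_nonneg _
  have hI2 : 0 ≤ ε ^ (2 * n + 3) * ∫ x in a..b, (g (n+1) x) ^ 2 :=
    mul_nonneg (by positivity) (intervalIntegral.integral_nonneg hab.le fun x _ => sq_nonneg _)
  unfold Fe at hF
  rw [← hE1, ← hE2, show 2 * (n + 2) - 1 = 2 * n + 3 by omega] at hF
  have hS1 : ∫ x in a..b, (g 0 x) ^ 2 ≤ S := by linarith
  have hS2 : ε ^ (2 * n + 3) * ∫ x in a..b, (g (n+1) x) ^ 2 ≤ S := by linarith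
  have hbad : ∀ p q, a ≤ p → p < q → q ≤ b →
      ∃ t ∈ Icc p q, ∃ j, j ≤ n ∧ 1 / (N * ε ^ (j+1)) ≤ |g j t| := by
    intro p q hap hpq hqb
    by_contra! hcon
    have hsub : Ioo p q ⊆ {t ∈ Ioo a b |
        ∀ ℓ : ℕ, 2 ≤ ℓ → ℓ ≤ (n + 2) - 1 → |iteratedDeriv ℓ u t| < 1 / (N * ε ^ ℓ)} := by
      intro t ht
      refine ⟨⟨by linarith [ht.1], by linarith [ht.2]⟩, ?_⟩
      intro ℓ h2 hℓ
      have := hcon t (Ioo_subset_Icc_self ht) (ℓ - 1) (by omega)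
      simp only [hg] at this
      rwa [show ℓ - 1 + 1 = ℓ by omega] at this
    have h0 := measure_mono_null hsub hnull
    rw [Real.volume_Ioo, ENNReal.ofReal_eq_zero] at h0
    linarith
  have core : ∀ p q A μ, a ≤ p → q ≤ b → 0 < μ → μ ≤ μ1 → q - p = ε * μ →
      (∀ x y, p ≤ x → y ≤ q → y - x = (q - p) / 3 ^ n → ∃ s ∈ Icc x y, |g 0 s| ≤ A) →
      μ ^ n ≤ K * ε * A := by
    intro p q A μ hap hqb hμ hμμ hM hA
    have hpq : p < q := by
      have : 0 < ε * μ := by positivity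
      linarith
    have hsub : Icc p q ⊆ Icc a b := Icc_subset_Icc hap hqb
    refine aux_core g n p q A S N ε μ hε hN hS hμ (hμμ.trans hμ1le) ?_ hM
      (fun j hj t ht => hd j hj t (hsub ht)) (hc.mono hsub) ?_ hA (hbad p q hap hpq hqb)
    · refine le_trans ?_ hμ1S
      gcongr
    · refine le_trans ?_ hS2
      gcongr
      apply intervalIntegral.integral_mono_interval hap hpq.le hqb
      · exact Filter.Eventually.of_forall fun x => sq_nonneg _
      · exact (by rw [uIcc_of_le hab.le]; exact hc.pow 2 :
          ContinuousOn (fun x => (g (n+1) x)^2) (uIcc a b)).intervalIntegrable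
  have hL : 0 < b - a := by linarith
  have hεpow : 0 < ε ^ (1 + 1 / (2 * (n:ℝ))) := Real.rpow_pos_of_pos hε _
  rcases le_or_gt (b - a) (ε * μ1) with hcase | hcase
  · -- short interval
    have hμ : 0 < (b - a) / ε := by positivity
    have hLμ : b - a = ε * ((b - a) / ε) := by field_simp
    have h1 := core a b (1 / Real.sqrt ε) ((b - a) / ε) le_rfl le_rfl hμ
      (by rw [div_le_iff₀ hε]; linarith) hLμ (by
        intro x y hx hy hxy
        have : 0 < (b - a) / 3 ^ n := by positivity
        exact ⟨(x + y) / 2, ⟨by linarith, by linarith⟩, by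
          rw [hg0]; exact (hv _ ⟨by linarith, by linarith⟩).le⟩)
    set μ := (b - a) / ε with hμdef
    have h2 : K * ε * (1 / Real.sqrt ε) = K * Real.sqrt ε := by
      have : ε = Real.sqrt ε * Real.sqrt ε := (Real.mul_self_sqrt hε.le).symm
      have h0 : 0 < Real.sqrt ε := Real.sqrt_pos.2 hε
      rw [mul_assoc]
      congr 1
      rw [mul_one_div, div_eq_iff h0.ne']
      exact this
    rw [h2] at h1
    have h3 : μ ≤ K ^ (1 / (n:ℝ)) * ε ^ (1 / (2 * (n:ℝ))) := by
      have h4 : (μ ^ n) ^ (1 / (n:ℝ)) ≤ (K * Real.sqrt ε) ^ (1 / (n:ℝ)) :=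
        Real.rpow_le_rpow (by positivity) h1 (by positivity)
      rw [one_div, Real.pow_rpow_inv_natCast hμ.le (by omega),
        Real.mul_rpow hK0.le (Real.sqrt_nonneg _), Real.sqrt_eq_rpow, ← Real.rpow_mul hε.le] at h4
      convert h4 using 3
      · rw [one_div]
      · field_simp
    calc b - a = ε * μ := hLμ
      _ ≤ ε * (K ^ (1 / (n:ℝ)) * ε ^ (1 / (2 * (n:ℝ)))) := by gcongr
      _ = K ^ (1 / (n:ℝ)) * ε ^ (1 + 1 / (2 * (n:ℝ))) := by
          rw [Real.rpow_add hε, Real.rpow_one]; ring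
      _ ≤ _ := by
          gcongr
          linarith
  · -- long interval
    have hεμ : 0 < ε * μ1 := by positivity
    set P := ⌈(b - a) / (ε * μ1)⌉₊ with hPdef
    have hP0 : 0 < P := Nat.ceil_pos.2 (by positivity)
    have hPR : (0:ℝ) < P := by exact_mod_cast hP0
    have hP1 : (b - a) / (ε * μ1) ≤ P := Nat.le_ceil _
    have hP2 : (P:ℝ) < (b - a) / (ε * μ1) + 1 := Nat.ceil_lt_add_one (by positivity)
    have hP3 : 1 < (b - a) / (ε * μ1) := by rwa [one_lt_div hεμ]
    have hP4 : (P:ℝ) * (ε * μ1) ≤ 2 * (b - a) := by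
      have : (P:ℝ) ≤ 2 * ((b - a) / (ε * μ1)) := by linarith
      calc (P:ℝ) * (ε * μ1) ≤ 2 * ((b - a) / (ε * μ1)) * (ε * μ1) := by gcongr
        _ = _ := by field_simp
    rw [div_le_iff₀ hεμ] at hP1
    obtain ⟨p, q, hap, hqb, hpq, hint⟩ := aux_pigeon (fun x => (g 0 x) ^ 2) a b hab.le
      (hc0.pow 2) P hP0
    have hT : ∫ x in p..q, (g 0 x) ^ 2 ≤ S / P := by
      rw [le_div_iff₀ hPR]
      linarith
    have hqp0 : 0 < q - p := by rw [hpq]; positivity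
    have h1 := core p q (Real.sqrt (S * 3 ^ n / (b - a))) ((b - a) / (ε * P)) hap hqb (by positivity)
      (by rw [div_le_iff₀ (by positivity)]; linarith) (by rw [hpq]; field_simp) (by
        intro x y hx hy hxy
        have h0 : 0 < y - x := by rw [hxy]; positivity
        obtain ⟨s, hs, hs'⟩ := aux_avg (g 0) p q x y (S / P) hx (by linarith) hy
          (hc0.mono (Icc_subset_Icc hap hqb)) hT
        refine ⟨s, hs, hs'.trans (le_of_eq ?_)⟩
        congr 1
        rw [hxy, hpq]
        field_simp)
    have h2 : μ1 / 2 ≤ (b - a) / (ε * P) := by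
      rw [le_div_iff₀ (by positivity)]
      linarith
    have h3 : (μ1 / 2) ^ n ≤ K * ε * Real.sqrt (S * 3 ^ n / (b - a)) :=
      (pow_le_pow_left₀ (by positivity) h2 n).trans h1
    have h4 : ((μ1 / 2) ^ n) ^ 2 ≤ (K * ε * Real.sqrt (S * 3 ^ n / (b - a))) ^ 2 :=
      pow_le_pow_left₀ (by positivity) h3 2
    rw [mul_pow, Real.sq_sqrt (by positivity), ← pow_mul, mul_comm n 2, ← mul_div_assoc,
      le_div_iff₀ hL] at h4
    have h5 : b - a ≤ K ^ 2 * S * 3 ^ n / (μ1 / 2) ^ (2 * n) * ε ^ 2 := by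
      rw [div_mul_eq_mul_div, le_div_iff₀ (by positivity)]
      linarith
    have h6 : ε ^ 2 ≤ ε ^ (1 + 1 / (2 * (n:ℝ))) := by
      rw [← Real.rpow_natCast ε 2]
      apply Real.rpow_le_rpow_of_exponent_ge hε hε1.le
      have : 1 / (2 * (n:ℝ)) ≤ 1 := by
        rw [div_le_one (by positivity)]; linarith
      push_cast
      linarith
    have hKp : 0 < K ^ (1 / (n:ℝ)) := Real.rpow_pos_of_pos hK0 _
    calc b - a ≤ _ := h5
      _ ≤ K ^ 2 * S * 3 ^ n / (μ1 / 2) ^ (2 * n) * ε ^ (1 + 1 / (2 * (n:ℝ))) := by gcongr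
      _ ≤ _ := by
          gcongr
          linarith
end

section
/- Let k ≥ 3 be an integer, S > 0 and N ≥ 1 with 2N²S ≥ 1. For each ε ∈ (0,1) let I(ε) = (a(ε), b(ε)) be a bounded open interval and u_ε a function that is k times continuously differentiable on a neighbourhood of the closure of I(ε) with F_ε(u_ε; I(ε)) ≤ S, such that the set { t ∈ I(ε) : |u_ε'(t)| < 1/√ε and |u_ε^{(ℓ)}(t)| < 1/(N ε^ℓ) for all ℓ ∈ {2,…,k−1} } has Lebesgue measure zero. If ε^{1+1/(2(k−2))} / |I(ε)| → 0 as ε → 0, then |{ t ∈ I(ε) : |u_ε'(t)| < 1/√ε }| / |I(ε)| → 0 as ε → 0. -/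
open MeasureTheory Set Filter

lemma sublevel_aux (g : ℕ → ℝ → ℝ) (δ h : ℝ) (hδ : 0 < δ) (hh : 0 < h) (j : ℕ) :
    ∀ K : Set ℝ, K.OrdConnected →
      (∀ i < j, ∀ t ∈ K, HasDerivAt (g i) (g (i+1) t) t) →
      (∀ t ∈ K, δ / h ^ j ≤ |g j t|) →
      volume {t ∈ K | |g 0 t| < δ} ≤ ENNReal.ofReal ((2 ^ (j+1) - 2) * h) := by
  induction j with
  | zero =>
    intro K hK hd hl
    have : {t ∈ K | |g 0 t| < δ} = ∅ := by
      ext t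
      simp only [mem_ofPred_eq, mem_empty_iff_false, iff_false, not_and, not_lt]
      intro ht
      simpa using hl t ht
    rw [this]; simp
  | succ j ih =>
    intro K hK hd hl
    set β := δ / h ^ j with hβ
    have hβ0 : 0 < β := by positivity
    have hlam : δ / h ^ (j+1) = β / h := by rw [hβ, pow_succ]; field_simp
    rw [hlam] at hl
    have hdj : ∀ t ∈ K, HasDerivAt (g j) (g (j+1) t) t := hd j (Nat.lt_succ_self j)
    have hcont : ContinuousOn (g j) K := fun t ht => (hdj t ht).continuousAt.continuousWithinAt
    have hexp : ∀ x ∈ K, ∀ y ∈ K, x < y → β / h * (y - x) ≤ |g j y - g j x| := by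
      intro x hx y hy hxy
      have hsub : Icc x y ⊆ K := hK.out hx hy
      obtain ⟨c, hc, hce⟩ := exists_hasDerivAt_eq_slope (g j) (g (j+1)) hxy (hcont.mono hsub)
        (fun t ht => hdj t (hsub (Ioo_subset_Icc_self ht)))
      have h1 := hl c (hsub (Ioo_subset_Icc_self hc))
      rw [hce, abs_div, abs_of_pos (sub_pos.2 hxy), le_div_iff₀ (sub_pos.2 hxy)] at h1
      exact h1
    have hmono : MonotoneOn (g j) K ∨ AntitoneOn (g j) K := by
      have hne : ∀ t ∈ K, g (j+1) t ≠ 0 := by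
        intro t ht h0
        have := hl t ht
        rw [h0, abs_zero] at this
        have : 0 < β / h := by positivity
        linarith
      rcases hasDerivWithinAt_forall_lt_or_forall_gt_of_forall_ne hK.convex
        (fun t ht => (hdj t ht).hasDerivWithinAt) hne with hneg | hpos
      · right
        refine antitoneOn_of_deriv_nonpos hK.convex hcont
          (fun t ht => (hdj t (interior_subset ht)).differentiableAt.differentiableWithinAt) ?_
        intro t ht
        rw [(hdj t (interior_subset ht)).deriv]
        exact (hneg t (interior_subset ht)).le
      · left
        refine monotoneOn_of_deriv_nonneg hK.convex hcont
          (fun t ht => (hdj t (interior_subset ht)).differentiableAt.differentiableWithinAt) ?_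
        intro t ht
        rw [(hdj t (interior_subset ht)).deriv]
        exact (hpos t (interior_subset ht)).le
    have hoc : ∀ K' : Set ℝ, (K' = {t ∈ K | β ≤ g j t} ∨ K' = {t ∈ K | g j t ≤ -β}) →
        K'.OrdConnected := by
      intro K' hK'
      refine ⟨fun x hx y hy z hz => ?_⟩
      rcases hK' with rfl | rfl
      · have hzK := hK.out hx.1 hy.1 hz
        refine ⟨hzK, ?_⟩
        rcases hmono with hm | hm
        · exact hx.2.trans (hm hx.1 hzK hz.1)
        · exact hy.2.trans (hm hzK hy.1 hz.2)
      · have hzK := hK.out hx.1 hy.1 hz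
        refine ⟨hzK, ?_⟩
        rcases hmono with hm | hm
        · exact (hm hzK hy.1 hz.2).trans hy.2
        · exact (hm hx.1 hzK hz.1).trans hx.2
    have h1 := ih {t ∈ K | β ≤ g j t} (hoc _ (Or.inl rfl))
      (fun i hi t ht => hd i (hi.trans (Nat.lt_succ_self j)) t ht.1)
      (fun t ht => ht.2.trans (le_abs_self _))
    have h2 := ih {t ∈ K | g j t ≤ -β} (hoc _ (Or.inr rfl))
      (fun i hi t ht => hd i (hi.trans (Nat.lt_succ_self j)) t ht.1)
      (fun t ht => by have := ht.2; have := neg_le_abs (g j t); linarith)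
    have h3 : volume {t ∈ K | |g j t| < β} ≤ ENNReal.ofReal (2 * h) := by
      refine (Real.volume_le_diam _).trans ?_
      have key : ∀ x ∈ {t ∈ K | |g j t| < β}, ∀ y ∈ {t ∈ K | |g j t| < β}, x < y →
          y - x ≤ 2 * h := by
        intro x hx y hy hxy
        have e1 := hexp x hx.1 y hy.1 hxy
        have e2 : |g j y - g j x| ≤ 2 * β := by
          have := abs_sub (g j y) (g j x)
          have := hx.2; have := hy.2
          linarith
        have e3 : β / h * (y - x) ≤ 2 * β := e1.trans e2
        rw [div_mul_eq_mul_div, div_le_iff₀ hh] at e3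
        nlinarith
      refine Metric.ediam_le fun x hx y hy => ?_
      rw [edist_dist, Real.dist_eq]
      refine ENNReal.ofReal_le_ofReal ?_
      rcases lt_trichotomy x y with hxy | hxy | hxy
      · rw [abs_sub_comm, abs_of_pos (sub_pos.2 hxy)]; exact key x hx y hy hxy
      · rw [hxy]; simp; exact hh.le
      · rw [abs_of_pos (sub_pos.2 hxy)]; exact key y hy x hx hxy
    have hcov : {t ∈ K | |g 0 t| < δ} ⊆ {t ∈ K | |g j t| < β} ∪
        ({t ∈ {t ∈ K | β ≤ g j t} | |g 0 t| < δ} ∪ {t ∈ {t ∈ K | g j t ≤ -β} | |g 0 t| < δ}) := by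
      intro t ht
      by_cases hc : |g j t| < β
      · exact Or.inl ⟨ht.1, hc⟩
      · right
        rcases le_abs.1 (not_lt.1 hc) with h' | h'
        · exact Or.inl ⟨⟨ht.1, h'⟩, ht.2⟩
        · exact Or.inr ⟨⟨ht.1, by linarith⟩, ht.2⟩
    have hpow : (0:ℝ) ≤ 2 ^ (j+1) - 2 := by
      have : (1:ℝ) ≤ 2 ^ j := one_le_pow₀ (by norm_num)
      rw [pow_succ]; linarith
    calc volume {t ∈ K | |g 0 t| < δ} ≤ _ := measure_mono hcov
      _ ≤ _ := measure_union_le _ _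
      _ ≤ _ := add_le_add le_rfl (measure_union_le _ _)
      _ ≤ _ := add_le_add h3 (add_le_add h1 h2)
      _ = _ := by
        rw [← ENNReal.ofReal_add (by positivity) (by positivity),
          ← ENNReal.ofReal_add (by positivity) (by positivity)]
        congr 1; ring

lemma osc_aux (v : ℕ → ℝ → ℝ) (p : ℕ) (K : Set ℝ) (hK : K.OrdConnected) (ε r N : ℝ)
    (hε : 0 < ε) (hr : r ≤ 1 / 4) (hN : 0 < N)
    (hder : ∀ i < p, ∀ t ∈ K, HasDerivAt (v i) (v (i+1) t) t)
    (hlen : ∀ x ∈ K, ∀ y ∈ K, |x - y| ≤ ε * r)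
    (htop : ∀ x ∈ K, ∀ y ∈ K, |v p x - v p y| ≤ 1 / (2 * N * ε ^ (p+1)))
    (t₀ : ℝ) (ht₀ : t₀ ∈ K) (j : ℕ) (hjp : j ≤ p)
    (hj : 1 / (N * ε ^ (j+1)) ≤ |v j t₀|)
    (hji : ∀ i, j < i → i ≤ p → |v i t₀| < 1 / (N * ε ^ (i+1))) :
    ∀ t ∈ K, 1 / (2 * N * ε ^ (j+1)) ≤ |v j t| := by
  have hD : ∀ i : ℕ, 1 / (N * ε ^ (i+1)) = 2 * (1 / (2 * N * ε ^ (i+1))) := by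
    intro i; field_simp
  have claim : ∀ n i, i + n = p → j ≤ i → ∀ t ∈ K,
      |v i t - v i t₀| ≤ 1 / (2 * N * ε ^ (i+1)) := by
    intro n
    induction n with
    | zero =>
      intro i hi _ t ht
      obtain rfl : i = p := by omega
      exact htop t ht t₀ ht₀
    | succ n ih =>
      intro i hi hji' t ht
      have hb : ∀ x ∈ K, ‖v (i+1) x‖ ≤ 3 * (1 / (2 * N * ε ^ (i+1+1))) := by
        intro x hx
        have e1 := ih (i+1) (by omega) (by omega) x hx
        have e2 := hji (i+1) (by omega) (by omega)
        rw [hD] at e2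
        rw [Real.norm_eq_abs]
        have : |v (i+1) x| ≤ |v (i+1) x - v (i+1) t₀| + |v (i+1) t₀| := by
          have := abs_add_le (v (i+1) x - v (i+1) t₀) (v (i+1) t₀)
          simpa using this
        linarith
      have e := hK.convex.norm_image_sub_le_of_norm_hasDerivWithin_le
        (fun x hx => (hder i (by omega) x hx).hasDerivWithinAt) hb ht₀ ht
      rw [Real.norm_eq_abs, Real.norm_eq_abs] at e
      have hl := hlen t ht t₀ ht₀
      have hl' : |t - t₀| ≤ ε * (1 / 4) := hl.trans (by gcongr)
      calc _ ≤ _ := e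
        _ ≤ 3 * (1 / (2 * N * ε ^ (i+1+1))) * (ε * (1/4)) := by gcongr
        _ = (3 / 4) * (1 / (2 * N * ε ^ (i+1))) := by field_simp; ring
        _ ≤ 1 * (1 / (2 * N * ε ^ (i+1))) := by gcongr; norm_num
        _ = _ := one_mul _
  intro t ht
  have e1 := claim (p - j) j (by omega) le_rfl t ht
  rw [hD] at hj
  have : |v j t₀| ≤ |v j t - v j t₀| + |v j t| := by
    have := abs_sub (v j t) (v j t - v j t₀)
    simp only [sub_sub_cancel] at this
    linarith
  linarith

lemma top_aux (f f' : ℝ → ℝ) (a b : ℝ) (K : Set ℝ) (hK : K.OrdConnected) (hKs : K ⊆ Ioo a b)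
    (hd : ∀ t ∈ K, HasDerivAt f (f' t) t) (hc : ContinuousOn f' (Icc a b))
    (ε r N S : ℝ) (k : ℕ) (hk : 1 ≤ k) (hε : 0 < ε) (hN : 0 < N) (hS : 0 < S)
    (hr : 4 * N ^ 2 * S * r ≤ 1)
    (hlen : ∀ x ∈ K, ∀ y ∈ K, |x - y| ≤ ε * r)
    (hF : ε ^ (2 * k - 1) * ∫ t in Ioo a b, (f' t) ^ 2 ≤ S) :
    ∀ x ∈ K, ∀ y ∈ K, |f x - f y| ≤ 1 / (2 * N * ε ^ (k-1)) := by
  have main : ∀ x ∈ K, ∀ y ∈ K, x ≤ y → |f y - f x| ≤ 1 / (2 * N * ε ^ (k-1)) := by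
    intro x hx y hy hxy
    have hsub : Icc x y ⊆ K := hK.out hx hy
    have hc' : ContinuousOn f' (Icc x y) := hc.mono (hsub.trans (hKs.trans Ioo_subset_Icc_self))
    have hint : IntervalIntegrable f' volume x y := hc'.intervalIntegrable_of_Icc hxy
    have hftc := intervalIntegral.integral_eq_sub_of_hasDerivAt (a := x) (b := y) (f := f)
      (f' := f') (fun t ht => hd t (hsub (by rwa [uIcc_of_le hxy] at ht))) hint
    have hsq : IntervalIntegrable (fun t => f' t ^ 2) volume x y :=
      (hc'.pow 2).intervalIntegrable_of_Icc hxy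
    have hsqI : ∫ t in x..y, f' t ^ 2 ≤ ∫ t in Ioo a b, (f' t) ^ 2 := by
      rw [intervalIntegral.integral_of_le hxy]
      refine setIntegral_mono_set ?_ ?_ ?_
      · exact ((hc.pow 2).integrableOn_Icc).mono_set Ioo_subset_Icc_self
      · exact Eventually.of_forall fun t => sq_nonneg _
      · exact (Ioc_subset_Icc_self.trans (hsub.trans hKs)).eventuallyLE
    set c : ℝ := ε ^ k / (2 * N * S) with hcdef
    have hc0 : 0 < c := by positivity
    have hpt : ∀ t, |f' t| ≤ (c * f' t ^ 2 + 1 / c) / 2 := by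
      intro t
      have h0 : 0 ≤ (c * |f' t| - 1) ^ 2 / c := by positivity
      have : (c * |f' t| - 1) ^ 2 / c = c * f' t ^ 2 - 2 * |f' t| + 1 / c := by
        rw [← sq_abs (f' t)]; field_simp; ring
      linarith
    have hI : |f y - f x| ≤ (c * ∫ t in x..y, f' t ^ 2) / 2 + (1 / c) / 2 * (y - x) := by
      rw [← hftc]
      calc _ ≤ ∫ t in x..y, |f' t| := intervalIntegral.abs_integral_le_integral_abs hxy
        _ ≤ ∫ t in x..y, (c / 2 * f' t ^ 2 + 1 / c / 2) := by
          refine intervalIntegral.integral_mono_on hxy hint.abs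
            ((hsq.const_mul _).add intervalIntegrable_const) fun t _ => ?_
          have := hpt t; linarith
        _ = _ := by
          rw [intervalIntegral.integral_add (hsq.const_mul _) intervalIntegrable_const,
            intervalIntegral.integral_const_mul, intervalIntegral.integral_const, smul_eq_mul]
          ring
    have hlen' : y - x ≤ ε * r := (le_abs_self _).trans (hlen y hy x hx)
    obtain ⟨q, rfl⟩ : ∃ q, k = q + 1 := ⟨k - 1, by omega⟩
    have e0 : 2 * (q + 1) - 1 = q + (q + 1) := by omega
    rw [e0] at hF
    simp only [Nat.add_sub_cancel]
    have hJ : ∫ t in x..y, f' t ^ 2 ≤ S / ε ^ (q + (q+1)) := by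
      rw [le_div_iff₀ (by positivity)]
      calc _ ≤ (∫ t in Ioo a b, (f' t) ^ 2) * ε ^ (q + (q+1)) := by gcongr
        _ ≤ S := by linarith
    calc _ ≤ _ := hI
      _ ≤ (c * (S / ε ^ (q + (q+1)))) / 2 + (1 / c) / 2 * (ε * r) := by gcongr
      _ = (1 + 4 * N ^ 2 * S * r) / 2 * (1 / (2 * N * ε ^ q)) := by
        rw [hcdef, pow_add ε q (q+1), pow_succ]; field_simp; ring
      _ ≤ 1 * (1 / (2 * N * ε ^ q)) := by gcongr; linarith
      _ = _ := one_mul _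
  intro x hx y hy
  rcases le_total x y with h | h
  · rw [abs_sub_comm]; exact main x hx y hy h
  · exact main y hy x hx h

lemma piece_aux (p : ℕ) (S : ℝ) (hS : 0 < S) (N : ℝ) (hN : 1 ≤ N) (a b ε : ℝ) (u : ℝ → ℝ)
    (hε : 0 < ε)
    (hder : ∀ i < p + 1, ∀ t ∈ Icc a b,
      HasDerivAt (iteratedDeriv (i+1) u) (iteratedDeriv (i+1+1) u t) t)
    (hcont : ContinuousOn (iteratedDeriv (p+2) u) (Icc a b))
    (hF : ε ^ (2 * (p+2) - 1) * ∫ t in Ioo a b, (iteratedDeriv (p+2) u t) ^ 2 ≤ S)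
    (hgood : volume {t ∈ Ioo a b | |deriv u t| < 1 / Real.sqrt ε ∧
        ∀ ℓ : ℕ, 2 ≤ ℓ → ℓ ≤ p + 1 → |iteratedDeriv ℓ u t| < 1 / (N * ε ^ ℓ)} = 0)
    (h r : ℝ) (hh : 0 < h) (hh1 : h ≤ 1) (hhp : 2 * N * Real.sqrt ε ≤ h ^ p)
    (hr : r ≤ 1 / 4) (hr2 : 4 * N ^ 2 * S * r ≤ 1) (c d : ℝ) (hcd : d - c ≤ ε * r) :
    volume {t ∈ Ioo a b ∩ Icc c d | |deriv u t| < 1 / Real.sqrt ε} ≤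
      ENNReal.ofReal (2 ^ (p+1) * (ε * h)) := by
  classical
  set K := Ioo a b ∩ Icc c d with hKdef
  have hK : K.OrdConnected := ordConnected_Ioo.inter ordConnected_Icc
  have hN0 : 0 < N := by linarith
  have hKs : K ⊆ Ioo a b := inter_subset_left
  have hKI : K ⊆ Icc a b := hKs.trans Ioo_subset_Icc_self
  have hlen : ∀ x ∈ K, ∀ y ∈ K, |x - y| ≤ ε * r := by
    intro x hx y hy
    rw [abs_le]
    have := hx.2.1; have := hx.2.2; have := hy.2.1; have := hy.2.2
    constructor <;> linarith
  by_cases hex : ∃ t₀ ∈ K, ∃ j ≤ p, 1 / (N * ε ^ (j+1)) ≤ |iteratedDeriv (j+1) u t₀|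
  · obtain ⟨t₀, ht₀, j₀, hj₀p, hj₀⟩ := hex
    let P : ℕ → Prop := fun j => 1 / (N * ε ^ (j+1)) ≤ |iteratedDeriv (j+1) u t₀|
    set j := Nat.findGreatest P p with hj
    have hPj : P j := Nat.findGreatest_spec hj₀p hj₀
    have hjp : j ≤ p := Nat.findGreatest_le p
    have hji : ∀ i, j < i → i ≤ p → |iteratedDeriv (i+1) u t₀| < 1 / (N * ε ^ (i+1)) :=
      fun i h1 h2 => not_le.1 (Nat.findGreatest_is_greatest (P := P) h1 h2)
    have htop := top_aux (iteratedDeriv (p+1) u) (iteratedDeriv (p+2) u) a b K hK hKs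
      (fun t ht => hder p (Nat.lt_succ_self p) t (hKI ht)) hcont ε r N S (p+2) (by omega) hε hN0 hS
      hr2 hlen hF
    have hlow := osc_aux (fun i => iteratedDeriv (i+1) u) p K hK ε r N hε hr hN0
      (fun i hi t ht => hder i (by omega) t (hKI ht)) hlen htop t₀ ht₀ j hjp hPj hji
    have hsε : 0 < Real.sqrt ε := Real.sqrt_pos.2 hε
    have hthr : 1 / Real.sqrt ε / (ε * h) ^ j ≤ 1 / (2 * N * ε ^ (j+1)) := by
      rw [div_div]
      refine one_div_le_one_div_of_le (by positivity) ?_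
      have h1 : h ^ p ≤ h ^ j := pow_le_pow_of_le_one hh.le hh1 hjp
      calc 2 * N * ε ^ (j+1) = (2 * N * Real.sqrt ε) * (Real.sqrt ε * ε ^ j) := by
            rw [pow_succ]; nth_rewrite 2 [← Real.mul_self_sqrt hε.le]; ring
        _ ≤ h ^ j * (Real.sqrt ε * ε ^ j) := by
            gcongr; exact hhp.trans h1
        _ = _ := by rw [mul_pow]; ring
    have := sublevel_aux (fun i => iteratedDeriv (i+1) u) (1 / Real.sqrt ε) (ε * h)
      (by positivity) (by positivity) j K hK (fun i hi t ht => hder i (by omega) t (hKI ht))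
      (fun t ht => hthr.trans (hlow t ht))
    simp only [zero_add, iteratedDeriv_one] at this
    refine this.trans (ENNReal.ofReal_le_ofReal ?_)
    have h2 : (2:ℝ) ^ (j+1) ≤ 2 ^ (p+1) := pow_le_pow_right₀ (by norm_num) (by omega)
    gcongr
    linarith
  · push Not at hex
    refine (measure_mono_null ?_ hgood).le.trans (zero_le)
    intro t ht
    refine ⟨ht.1.1, ht.2, fun ℓ h1 h2 => ?_⟩
    obtain ⟨q, rfl⟩ : ∃ q, ℓ = q + 1 := ⟨ℓ - 1, by omega⟩
    exact hex t ht.1 q (by omega)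

lemma core_aux (p : ℕ) (S : ℝ) (hS : 0 < S) (N : ℝ) (hN : 1 ≤ N) (a b ε : ℝ) (u : ℝ → ℝ)
    (hε : 0 < ε) (hab : a < b)
    (hder : ∀ i < p + 1, ∀ t ∈ Icc a b,
      HasDerivAt (iteratedDeriv (i+1) u) (iteratedDeriv (i+1+1) u t) t)
    (hcont : ContinuousOn (iteratedDeriv (p+2) u) (Icc a b))
    (hF : ε ^ (2 * (p+2) - 1) * ∫ t in Ioo a b, (iteratedDeriv (p+2) u t) ^ 2 ≤ S)
    (hgood : volume {t ∈ Ioo a b | |deriv u t| < 1 / Real.sqrt ε ∧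
        ∀ ℓ : ℕ, 2 ≤ ℓ → ℓ ≤ p + 1 → |iteratedDeriv ℓ u t| < 1 / (N * ε ^ ℓ)} = 0)
    (h r : ℝ) (hh : 0 < h) (hh1 : h ≤ 1) (hhp : 2 * N * Real.sqrt ε ≤ h ^ p) (hr0 : 0 < r)
    (hr : r ≤ 1 / 4) (hr2 : 4 * N ^ 2 * S * r ≤ 1) :
    (volume {t ∈ Ioo a b | |deriv u t| < 1 / Real.sqrt ε}).toReal / (b - a) ≤
      2 ^ (p+1) * (h / r + ε * h / (b - a)) := by
  have hL : 0 < b - a := sub_pos.2 hab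
  set w := ε * r with hw
  have hw0 : 0 < w := by positivity
  set n := ⌈(b - a) / w⌉₊ with hn
  have hn1 : (b - a) / w ≤ n := Nat.le_ceil _
  have hn2 : (n:ℝ) < (b - a) / w + 1 := Nat.ceil_lt_add_one (by positivity)
  have hcov : {t ∈ Ioo a b | |deriv u t| < 1 / Real.sqrt ε} ⊆
      ⋃ i ∈ Finset.range n,
        {t ∈ Ioo a b ∩ Icc (a + i * w) (a + (i+1) * w) | |deriv u t| < 1 / Real.sqrt ε} := by
    intro t ht
    have hta : 0 ≤ t - a := by linarith [ht.1.1]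
    have f1 : (⌊(t - a) / w⌋₊ : ℝ) ≤ (t - a) / w := Nat.floor_le (by positivity)
    have f2 : (t - a) / w < ⌊(t - a) / w⌋₊ + 1 := Nat.lt_floor_add_one _
    have f3 : (t - a) / w < (b - a) / w := by
      have := ht.1.2
      gcongr
    have f4 : ⌊(t - a) / w⌋₊ < n := by
      have : (⌊(t - a) / w⌋₊ : ℝ) < n := by linarith
      exact_mod_cast this
    rw [le_div_iff₀ hw0] at f1
    rw [div_lt_iff₀ hw0] at f2
    simp only [mem_iUnion]
    exact ⟨⌊(t - a) / w⌋₊, Finset.mem_range.2 f4, ⟨ht.1, by linarith, by linarith⟩, ht.2⟩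
  set B := 2 ^ (p+1) * (ε * h) with hB
  have hB0 : 0 < B := by positivity
  have hvol : volume {t ∈ Ioo a b | |deriv u t| < 1 / Real.sqrt ε} ≤ ENNReal.ofReal (n * B) := by
    calc _ ≤ _ := measure_mono hcov
      _ ≤ _ := measure_biUnion_finset_le _ _
      _ ≤ ∑ i ∈ Finset.range n, ENNReal.ofReal B := by
        refine Finset.sum_le_sum fun i _ => ?_
        exact piece_aux p S hS N hN a b ε u hε hder hcont hF hgood h r hh hh1 hhp hr hr2 _ _
          (by rw [← hw]; linarith)
      _ = _ := by
        rw [Finset.sum_const, Finset.card_range, nsmul_eq_mul,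
          ENNReal.ofReal_mul (p := (n:ℝ)) (by positivity), ENNReal.ofReal_natCast]
  have hreal := ENNReal.toReal_le_of_le_ofReal (by positivity) hvol
  rw [div_le_iff₀ hL]
  calc _ ≤ _ := hreal
    _ ≤ ((b - a) / w + 1) * B := by gcongr
    _ = _ := by rw [hB, hw]; field_simp

/-- Proposition 4.6 of the paper: if the intervals `I(ε)` are large compared
with `ε^{1+1/(2(k-2))}` and avoid the good set, then the relative measure in `I(ε)` of the
set where `|u_ε'| < 1/√ε` tends to `0` as `ε → 0`. -/
theorem relative_measure_below_threshold_vanishes (k : ℕ) (hk : 3 ≤ k)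
    (S : ℝ) (hS : 0 < S) (N : ℝ) (hN : 1 ≤ N) (hNS : 1 ≤ 2 * N ^ 2 * S)
    (a b : ℝ → ℝ) (u : ℝ → ℝ → ℝ)
    (hab : ∀ ε ∈ Ioo (0:ℝ) 1, a ε < b ε)
    (hu : ∀ ε ∈ Ioo (0:ℝ) 1,
      ∃ U : Set ℝ, IsOpen U ∧ Icc (a ε) (b ε) ⊆ U ∧ ContDiffOn ℝ k (u ε) U)
    (hF : ∀ ε ∈ Ioo (0:ℝ) 1, Fe k ε (u ε) (a ε) (b ε) ≤ S)
    (hgood : ∀ ε ∈ Ioo (0:ℝ) 1,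
      volume {t ∈ Ioo (a ε) (b ε) | |deriv (u ε) t| < 1 / Real.sqrt ε ∧
        ∀ ℓ : ℕ, 2 ≤ ℓ → ℓ ≤ k - 1 → |iteratedDeriv ℓ (u ε) t| < 1 / (N * ε ^ ℓ)} = 0)
    (hlarge : Tendsto (fun ε : ℝ => ε ^ (1 + (1:ℝ) / (2 * ((k:ℝ) - 2))) / (b ε - a ε))
      (nhdsWithin 0 (Ioo (0:ℝ) 1)) (nhds 0)) :
    Tendsto (fun ε : ℝ =>
        (volume {t ∈ Ioo (a ε) (b ε) | |deriv (u ε) t| < 1 / Real.sqrt ε}).toReal /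
          (b ε - a ε))
      (nhdsWithin 0 (Ioo (0:ℝ) 1)) (nhds 0) := by
  obtain ⟨p, rfl⟩ : ∃ p, k = p + 2 := ⟨k - 2, by omega⟩
  have hp1 : 1 ≤ p := by omega
  have hp0 : (0:ℝ) < p := by exact_mod_cast hp1
  have hN0 : 0 < N := by linarith
  have hexp : (1:ℝ) / (2 * (((p + 2 : ℕ) : ℝ) - 2)) = 1 / (2 * p) := by
    push_cast; congr 2; ring
  rw [hexp] at hlarge
  set e : ℝ := 1 / (2 * p) with he
  have he0 : 0 < e := by positivity
  set c : ℝ := (2 * N) ^ ((1:ℝ) / p) with hc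
  have hc0 : 0 < c := by positivity
  obtain ⟨r, hr0, hr, hr2⟩ : ∃ r : ℝ, 0 < r ∧ r ≤ 1 / 4 ∧ 4 * N ^ 2 * S * r ≤ 1 := by
    refine ⟨min (1/4) (1 / (4 * N ^ 2 * S)), by positivity, min_le_left _ _, ?_⟩
    calc _ ≤ 4 * N ^ 2 * S * (1 / (4 * N ^ 2 * S)) := by gcongr; exact min_le_right _ _
      _ = 1 := by field_simp
  have hh0 : Tendsto (fun ε : ℝ => c * ε ^ e) (nhdsWithin 0 (Ioo (0:ℝ) 1)) (nhds 0) := by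
    have h1 : Tendsto (fun ε : ℝ => c * ε ^ e) (nhds 0) (nhds (c * 0 ^ e)) :=
      ((Real.continuous_rpow_const he0.le).tendsto 0).const_mul c
    rw [Real.zero_rpow he0.ne', mul_zero] at h1
    exact h1.mono_left nhdsWithin_le_nhds
  have hlim : Tendsto (fun ε : ℝ => 2 ^ (p+1) * ((c * ε ^ e) / r +
      c * (ε ^ (1 + e) / (b ε - a ε)))) (nhdsWithin 0 (Ioo (0:ℝ) 1)) (nhds 0) := by
    have := ((hh0.div_const r).add (hlarge.const_mul c)).const_mul ((2:ℝ) ^ (p+1))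
    simpa using this
  refine squeeze_zero' ?_ ?_ hlim
  · filter_upwards [self_mem_nhdsWithin] with ε hε
    have := hab ε hε
    exact div_nonneg ENNReal.toReal_nonneg (by linarith)
  · filter_upwards [self_mem_nhdsWithin, hh0.eventually (gt_mem_nhds one_pos)] with ε hε hlt
    have hε0 : 0 < ε := hε.1
    obtain ⟨U, hU, hIU, hCD⟩ := hu ε hε
    have hder : ∀ i < p + 1, ∀ t ∈ Icc (a ε) (b ε),
        HasDerivAt (iteratedDeriv (i+1) (u ε)) (iteratedDeriv (i+1+1) (u ε) t) t := by
      intro i hi t ht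
      have hd1 : DifferentiableWithinAt ℝ (iteratedDerivWithin (i+1) (u ε) U) U t :=
        hCD.differentiableOn_iteratedDerivWithin (by exact_mod_cast (by omega : i + 1 < p + 2))
          hU.uniqueDiffOn t (hIU ht)
      have hd2 : DifferentiableAt ℝ (iteratedDeriv (i+1) (u ε)) t :=
        (hd1.differentiableAt (hU.mem_nhds (hIU ht))).congr_of_eventuallyEq
          ((iteratedDerivWithin_of_isOpen hU).symm.eventuallyEq_of_mem (hU.mem_nhds (hIU ht)))
      rw [iteratedDeriv_succ (n := i+1)]
      exact hd2.hasDerivAt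
    have hcont : ContinuousOn (iteratedDeriv (p+2) (u ε)) (Icc (a ε) (b ε)) :=
      ((hCD.continuousOn_iteratedDerivWithin le_rfl hU.uniqueDiffOn).congr
        (iteratedDerivWithin_of_isOpen hU).symm).mono hIU
    have hF' : ε ^ (2 * (p+2) - 1) *
        ∫ t in Ioo (a ε) (b ε), (iteratedDeriv (p+2) (u ε) t) ^ 2 ≤ S := by
      have h1 := hF ε hε
      have h2 : 0 ≤ ∫ t in Ioo (a ε) (b ε), min ((deriv (u ε) t) ^ 2) (1 / ε) :=
        integral_nonneg fun t => le_min (sq_nonneg _) (by positivity)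
      unfold Fe at h1
      linarith
    have hpow : 2 * N * Real.sqrt ε ≤ (c * ε ^ e) ^ p := by
      rw [mul_pow, hc, ← Real.rpow_natCast, ← Real.rpow_mul (by positivity),
        ← Real.rpow_natCast, ← Real.rpow_mul hε0.le, Real.sqrt_eq_rpow, he]
      have e1 : (1:ℝ) / p * p = 1 := by field_simp
      have e2 : (1:ℝ) / (2 * p) * p = 1 / 2 := by field_simp
      rw [e1, e2, Real.rpow_one]
    have := core_aux p S hS N hN (a ε) (b ε) ε (u ε) hε0 (hab ε hε) hder hcont hF'
      (hgood ε hε) (c * ε ^ e) r (by positivity) hlt.le hpow hr0 hr hr2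
    refine this.trans (le_of_eq ?_)
    rw [Real.rpow_add hε0, Real.rpow_one]
    ring
end
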